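/- Binding property of the initializer scheme against post-commitment attacks: let M be a unitary from ℂ^d⊗ℂ^s to ℂ^{d_A}⊗ℂ^{d_B}, let |Ω⟩ ∈ ℂ^s⊗ℂ^k be a unit vector, and for a density matrix ρ on ℂ^d define Ψ(ρ) = (M⊗I_k)(ρ⊗|Ω⟩⟨Ω|)(M⊗I_k)†. Suppose there is a density matrix σ_A on ℂ^{d_A} with Tr_{BK}[Ψ(ρ)] = σ_A for every density matrix ρ on ℂ^d. Then for every quantum channel Ξ from d_A×d_A to d_A×d_A complex matrices there exists a real number λ with 0 ≤ λ ≤ 1, independent of ρ, such that for every density matrix ρ on ℂ^d, (I_d⊗⟨Ω|) (M⊗I_k)† [(Ξ⊗id_{BK})(Ψ(ρ))] (M⊗I_k) (I_d⊗|Ω⟩) = λ·ρ, where Ξ⊗id_{BK} applies Ξ to the first tensor factor ℂ^{d_A} and the identity to the remaining factors. -/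

import Mathlib

open Matrix Kronecker
open scoped ComplexOrder

noncomputable section

/-- A density matrix: positive semidefinite with trace 1. -/
def IsDensity {n : Type*} [Fintype n] (ρ : Matrix n n ℂ) : Prop :=
  ρ.PosSemidef ∧ ρ.trace = 1

/-- The outer product `|v⟩⟨v|`. -/
def outer {n : Type*} (v : n → ℂ) : Matrix n n ℂ :=
  Matrix.of fun i j => v i * (starRingEnd ℂ) (v j)

/-- Partial trace over the second tensor factor. -/
def ptrace2 {m n : Type*} [Fintype n] (M : Matrix (m × n) (m × n) ℂ) :
    Matrix m m ℂ := Matrix.of fun i i' => ∑ j, M (i, j) (i', j)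

/-- Partial trace over the first tensor factor. -/
def ptrace1 {m n : Type*} [Fintype m] (M : Matrix (m × n) (m × n) ℂ) :
    Matrix n n ℂ := Matrix.of fun j j' => ∑ i, M (i, j) (i, j')

/-- `(M, ω)` is a universal quantum masker for `d`-dimensional states:
`M` is a unitary from `ℂ^d ⊗ ℂ^s` to `ℂ^{dA} ⊗ ℂ^{dB}`, `ω` is a density matrix on `ℂ^s`,
and both marginals of `Φ(ρ) = M (ρ ⊗ ω) M†` are independent of the input density matrix `ρ`. -/
def IsMasker (d s dA dB : ℕ) (M : Matrix (Fin dA × Fin dB) (Fin d × Fin s) ℂ)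
    (ω : Matrix (Fin s) (Fin s) ℂ) : Prop :=
  Mᴴ * M = 1 ∧ M * Mᴴ = 1 ∧ IsDensity ω ∧
  ∃ (σA : Matrix (Fin dA) (Fin dA) ℂ) (σB : Matrix (Fin dB) (Fin dB) ℂ),
    IsDensity σA ∧ IsDensity σB ∧
    ∀ ρ : Matrix (Fin d) (Fin d) ℂ, IsDensity ρ →
      ptrace2 (M * (ρ ⊗ₖ ω) * Mᴴ) = σA ∧ ptrace1 (M * (ρ ⊗ₖ ω) * Mᴴ) = σB

/-- Von Neumann entropy in bits: `-∑ λ log₂ λ` over the eigenvalues. -/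
def vNEntropy {n : Type*} [Fintype n] [DecidableEq n] (ρ : Matrix n n ℂ) : ℝ :=
  if h : ρ.IsHermitian then -∑ i, h.eigenvalues i * Real.logb 2 (h.eigenvalues i)
  else 0

/-- A linear map between matrix algebras is a quantum channel (CPTP map) if it admits a
Kraus representation `A ↦ ∑ k, K k * A * (K k)ᴴ` with `∑ k, (K k)ᴴ * K k = 1`. -/
def IsCPTP {m n : Type*} [Fintype m] [Fintype n] [DecidableEq m]
    (E : Matrix m m ℂ →ₗ[ℂ] Matrix n n ℂ) : Prop :=
  ∃ (r : ℕ) (K : Fin r → Matrix n m ℂ),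
    (∀ A, E A = ∑ k, K k * A * (K k)ᴴ) ∧ (∑ k, (K k)ᴴ * K k = 1)

/-- Partial trace over the second and third factors of `A ⊗ B ⊗ K`
(grouped as `(A × B) × K`). -/
def ptraceBK {a b c : Type*} [Fintype b] [Fintype c]
    (T : Matrix ((a × b) × c) ((a × b) × c) ℂ) : Matrix a a ℂ :=
  Matrix.of fun i i' => ∑ j, ∑ x, T ((i, j), x) ((i', j), x)

/-- Partial trace over the first factor of `A ⊗ B ⊗ K` (grouped as `(A × B) × K`). -/
def ptraceA3 {a b c : Type*} [Fintype a]
    (T : Matrix ((a × b) × c) ((a × b) × c) ℂ) : Matrix (b × c) (b × c) ℂ :=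
  Matrix.of fun q q' => ∑ i, T ((i, q.1), q.2) ((i, q'.1), q'.2)

/-- The tripartite state `Ψ(ρ) = (M ⊗ I_k)(ρ ⊗ |Ω⟩⟨Ω|)(M ⊗ I_k)†` on
`ℂ^{dA} ⊗ ℂ^{dB} ⊗ ℂ^k`. -/
def maskedTriState {d s dA dB k : ℕ}
    (M : Matrix (Fin dA × Fin dB) (Fin d × Fin s) ℂ)
    (Ω : Fin s × Fin k → ℂ) (ρ : Matrix (Fin d) (Fin d) ℂ) :
    Matrix ((Fin dA × Fin dB) × Fin k) ((Fin dA × Fin dB) × Fin k) ℂ :=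
  (M ⊗ₖ (1 : Matrix (Fin k) (Fin k) ℂ)) *
    (Matrix.reindex (Equiv.prodAssoc (Fin d) (Fin s) (Fin k)).symm
      (Equiv.prodAssoc (Fin d) (Fin s) (Fin k)).symm (ρ ⊗ₖ outer Ω)) *
    (M ⊗ₖ (1 : Matrix (Fin k) (Fin k) ℂ))ᴴ

/-- The extension `Ξ ⊗ id` of a linear map `Ξ` acting on the first tensor factor of
`A ⊗ B ⊗ K` (grouped as `(A × B) × K`). -/
def extFirst {a b c : Type*} (Ξ : Matrix a a ℂ →ₗ[ℂ] Matrix a a ℂ)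
    (T : Matrix ((a × b) × c) ((a × b) × c) ℂ) : Matrix ((a × b) × c) ((a × b) × c) ℂ :=
  Matrix.of fun q q' =>
    Ξ (Matrix.of fun i i' => T ((i, q.1.2), q.2) ((i', q'.1.2), q'.2)) q.1.1 q'.1.1

/-- The sandwich `(I_d ⊗ ⟨Ω|) T (I_d ⊗ |Ω⟩)` of an operator `T` on `ℂ^d ⊗ (ℂ^s ⊗ ℂ^k)`
(grouped as `(d × s) × k`). -/
def sandwichΩ {a s k : Type*} [Fintype s] [Fintype k]
    (Ω : s × k → ℂ) (T : Matrix ((a × s) × k) ((a × s) × k) ℂ) : Matrix a a ℂ :=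
  Matrix.of fun c c' => ∑ x : s × k, ∑ y : s × k,
    (starRingEnd ℂ) (Ω x) * T ((c, x.1), x.2) ((c', y.1), y.2) * Ω y

/-- The operator `I_a ⊗ |Ω⟩`. -/
def tensorVec (a : Type*) {s k : Type*} [DecidableEq a] (Ω : s × k → ℂ) : Matrix ((a × s) × k) a ℂ :=
  Matrix.of fun q c => if q.1.1 = c then Ω (q.1.2, q.2) else 0

theorem reindex_kronecker_outer {a s k : Type*} [Fintype a] [DecidableEq a]
    (Ω : s × k → ℂ) (ρ : Matrix a a ℂ) :
    Matrix.reindex (Equiv.prodAssoc a s k).symm (Equiv.prodAssoc a s k).symm (ρ ⊗ₖ outer Ω)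
      = tensorVec a Ω * ρ * (tensorVec a Ω)ᴴ := by
  ext ⟨⟨c, t⟩, x⟩ ⟨⟨c', t'⟩, x'⟩
  simp [tensorVec, outer, Matrix.mul_apply, apply_ite (starRingEnd ℂ)]
  ring

theorem mul_tensorVec_apply {a s k m : Type*} [Fintype a] [DecidableEq a] [Fintype s] [Fintype k]
    (Ω : s × k → ℂ) (T : Matrix m ((a × s) × k) ℂ) (q : m) (c : a) :
    (T * tensorVec a Ω) q c = ∑ y : s × k, T q ((c, y.1), y.2) * Ω y := by
  simp only [tensorVec, Matrix.mul_apply, Matrix.of_apply, Fintype.sum_prod_type, mul_ite, mul_zero,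
    Finset.sum_ite_irrel, Finset.sum_const_zero, Finset.sum_ite_eq', Finset.mem_univ, if_true]

theorem conjTranspose_tensorVec_mul_apply {a s k m : Type*} [Fintype a] [DecidableEq a]
    [Fintype s] [Fintype k] (Ω : s × k → ℂ) (T : Matrix ((a × s) × k) m ℂ) (c : a) (q : m) :
    ((tensorVec a Ω)ᴴ * T) c q = ∑ x : s × k, (starRingEnd ℂ) (Ω x) * T ((c, x.1), x.2) q := by
  have h := congrArg star (mul_tensorVec_apply Ω Tᴴ q c)
  rw [← Matrix.conjTranspose_apply, Matrix.conjTranspose_mul,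
    Matrix.conjTranspose_conjTranspose] at h
  simpa [star_sum, mul_comm] using h

theorem sandwichΩ_eq {a s k : Type*} [Fintype a] [DecidableEq a] [Fintype s] [Fintype k]
    (Ω : s × k → ℂ) (T : Matrix ((a × s) × k) ((a × s) × k) ℂ) :
    sandwichΩ Ω T = (tensorVec a Ω)ᴴ * T * tensorVec a Ω := by
  ext c c'
  simp only [sandwichΩ, Matrix.of_apply, mul_tensorVec_apply, conjTranspose_tensorVec_mul_apply,
    Finset.sum_mul]
  exact Finset.sum_comm

theorem extFirst_eq_sum_kraus {a b c : Type*} [Fintype a] [Fintype b] [Fintype c]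
    [DecidableEq b] [DecidableEq c] {r : ℕ}
    (Ξ : Matrix a a ℂ →ₗ[ℂ] Matrix a a ℂ) (K : Fin r → Matrix a a ℂ)
    (hK : ∀ A, Ξ A = ∑ l, K l * A * (K l)ᴴ)
    (T : Matrix ((a × b) × c) ((a × b) × c) ℂ) :
    extFirst Ξ T = ∑ l, ((K l ⊗ₖ (1 : Matrix b b ℂ)) ⊗ₖ (1 : Matrix c c ℂ)) * T *
      ((K l ⊗ₖ (1 : Matrix b b ℂ)) ⊗ₖ (1 : Matrix c c ℂ))ᴴ := by
  ext ⟨⟨i, j⟩, x⟩ ⟨⟨i', j'⟩, x'⟩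
  simp [extFirst, hK, Matrix.sum_apply, Matrix.mul_apply, Matrix.one_apply, Fintype.sum_prod_type,
    apply_ite (starRingEnd ℂ)]

theorem trace_kronecker_mul {a b c : Type*} [Fintype a] [Fintype b] [Fintype c]
    [DecidableEq b] [DecidableEq c] (K : Matrix a a ℂ)
    (T : Matrix ((a × b) × c) ((a × b) × c) ℂ) :
    (((K ⊗ₖ (1 : Matrix b b ℂ)) ⊗ₖ (1 : Matrix c c ℂ)) * T).trace = (K * ptraceBK T).trace := by
  simp only [ptraceBK, Matrix.trace, Matrix.diag_apply, Matrix.mul_apply, Fintype.sum_prod_type,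
    Matrix.kroneckerMap_apply, Matrix.one_apply, Matrix.of_apply, mul_ite, mul_one, mul_zero,
    ite_mul, zero_mul, Finset.sum_ite_eq, Finset.mem_univ, if_true, Finset.mul_sum]
  refine Finset.sum_congr rfl fun i _ => ?_
  rw [Finset.sum_comm (s := (Finset.univ : Finset a))]
  exact Finset.sum_congr rfl fun j _ => Finset.sum_comm

/-- A linear map vanishing on all density matrices is zero. -/
theorem linearMap_eq_zero_of_isDensity {n E : Type*} [Fintype n] [DecidableEq n]
    [AddCommGroup E] [Module ℂ E] (L : Matrix n n ℂ →ₗ[ℂ] E)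
    (h : ∀ ρ, IsDensity ρ → L ρ = 0) : L = 0 := by
  have hpos (P : Matrix n n ℂ) (hP : P.PosSemidef) : L P = 0 := by
    by_cases h0 : P.trace = 0
    · rw [hP.trace_eq_zero_iff.1 h0, map_zero]
    · have hd : IsDensity (P.trace⁻¹ • P) :=
        ⟨hP.smul (inv_nonneg.2 hP.trace_nonneg), by simp [h0]⟩
      have := h _ hd
      rw [map_smul] at this
      exact (smul_eq_zero.1 this).resolve_left (inv_ne_zero h0)
  have hv (u v : n → ℂ) : L (Matrix.vecMulVec u (star v)) = 0 := by
    have key : (4 : ℂ) • Matrix.vecMulVec u (star v) =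
        Matrix.vecMulVec (u + v) (star (u + v)) - Matrix.vecMulVec (u - v) (star (u - v))
        + Complex.I • (Matrix.vecMulVec (u + Complex.I • v) (star (u + Complex.I • v))
          - Matrix.vecMulVec (u - Complex.I • v) (star (u - Complex.I • v))) := by
      ext i j
      simp [Matrix.vecMulVec_apply]
      linear_combination (2 * u i * (starRingEnd ℂ) (v j) - 2 * v i * (starRingEnd ℂ) (u j)) *
        Complex.I_mul_I
    have h4 := congrArg L key
    simp only [map_add, map_sub, map_smul, hpos _ (Matrix.posSemidef_vecMulVec_self_star _),
      sub_zero, smul_zero, add_zero] at h4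
    exact (smul_eq_zero.1 h4).resolve_left (by norm_num)
  refine Matrix.ext_linearMap _ fun i j => LinearMap.ext_ring ?_
  have := hv (Pi.single i 1) (Pi.single j 1)
  rw [← Pi.single_star] at this
  simpa [Matrix.single_eq_single_vecMulVec_single] using this

theorem normSq_trace_mul_le {n : Type*} [Fintype n] [DecidableEq n] {σ : Matrix n n ℂ}
    (hσ : IsDensity σ) (K : Matrix n n ℂ) :
    ((Complex.normSq (K * σ).trace : ℝ) : ℂ) ≤ (Kᴴ * K * σ).trace := by
  set w := (K * σ).trace with hw
  have hpos := (hσ.1.mul_mul_conjTranspose_same (K - w • (1 : Matrix n n ℂ))).trace_nonneg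
  have hstar : (σ * Kᴴ).trace = star w := by
    rw [hw, ← Matrix.trace_conjTranspose, Matrix.conjTranspose_mul, hσ.1.isHermitian.eq]
  have hexp : ((K - w • (1 : Matrix n n ℂ)) * σ * (K - w • (1 : Matrix n n ℂ))ᴴ).trace
      = (Kᴴ * K * σ).trace - w * star w := by
    simp only [Matrix.conjTranspose_sub, Matrix.conjTranspose_smul, Matrix.conjTranspose_one,
      Matrix.sub_mul, Matrix.mul_sub, Matrix.smul_mul, Matrix.mul_smul, Matrix.one_mul,
      Matrix.mul_one, Matrix.trace_sub, Matrix.trace_smul, smul_eq_mul, hstar, hσ.2, ← hw]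
    rw [Matrix.trace_mul_comm (K * σ), ← Matrix.mul_assoc]
    ring
  rw [hexp, sub_nonneg] at hpos
  rwa [← Complex.mul_conj]

/-- binding property of the initializer scheme against post-commitment
attacks: any channel applied to the `A` share only shrinks the state by a constant factor
`λ ∈ [0,1]` independent of `ρ`. -/
theorem binding_against_post_commitment_attack
    (d s dA dB k : ℕ)
    (M : Matrix (Fin dA × Fin dB) (Fin d × Fin s) ℂ)
    (hM : Mᴴ * M = 1 ∧ M * Mᴴ = 1)
    (Ω : Fin s × Fin k → ℂ) (hΩ : ∑ x, ‖Ω x‖ ^ 2 = 1)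
    (σA : Matrix (Fin dA) (Fin dA) ℂ) (hσA : IsDensity σA)
    (hconst : ∀ ρ : Matrix (Fin d) (Fin d) ℂ, IsDensity ρ →
      ptraceBK (maskedTriState M Ω ρ) = σA)
    (Ξ : Matrix (Fin dA) (Fin dA) ℂ →ₗ[ℂ] Matrix (Fin dA) (Fin dA) ℂ)
    (hΞ : IsCPTP Ξ) :
    ∃ lam : ℝ, 0 ≤ lam ∧ lam ≤ 1 ∧
      ∀ ρ : Matrix (Fin d) (Fin d) ℂ, IsDensity ρ →
        sandwichΩ Ω
          ((M ⊗ₖ (1 : Matrix (Fin k) (Fin k) ℂ))ᴴ *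
            extFirst Ξ (maskedTriState M Ω ρ) *
            (M ⊗ₖ (1 : Matrix (Fin k) (Fin k) ℂ)))
          = (lam : ℂ) • ρ := by
  obtain ⟨r, K, hK, hKK⟩ := hΞ
  set V : Matrix ((Fin dA × Fin dB) × Fin k) (Fin d) ℂ :=
    (M ⊗ₖ (1 : Matrix (Fin k) (Fin k) ℂ)) * tensorVec (Fin d) Ω with hV
  have hΨ (ρ : Matrix (Fin d) (Fin d) ℂ) : maskedTriState M Ω ρ = V * ρ * Vᴴ := by
    simp only [maskedTriState, reindex_kronecker_outer, hV, Matrix.conjTranspose_mul,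
      Matrix.mul_assoc]
  have hL (X : Matrix (Fin d) (Fin d) ℂ) : ptraceBK (V * X * Vᴴ) = X.trace • σA := by
    let L : Matrix (Fin d) (Fin d) ℂ →ₗ[ℂ] Matrix (Fin dA) (Fin dA) ℂ :=
      { toFun := fun X => ptraceBK (V * X * Vᴴ) - X.trace • σA
        map_add' := fun X Y => by
          ext i j
          simp [ptraceBK, Matrix.mul_add, Matrix.add_mul, Finset.sum_add_distrib, add_mul]
          ring
        map_smul' := fun z X => by
          ext i j
          simp [ptraceBK, Finset.mul_sum, mul_sub, mul_assoc] }
    have h0 : L = 0 := linearMap_eq_zero_of_isDensity L fun ρ hρ => by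
      simp [L, ← hΨ, hconst ρ hρ, hρ.2]
    exact sub_eq_zero.1 (LinearMap.congr_fun h0 X)
  have hW (l : Fin r) : Vᴴ * ((K l ⊗ₖ (1 : Matrix (Fin dB) (Fin dB) ℂ)) ⊗ₖ
      (1 : Matrix (Fin k) (Fin k) ℂ)) * V = (K l * σA).trace • (1 : Matrix _ _ ℂ) := by
    refine Matrix.ext_iff_trace_mul_right.2 fun X => ?_
    rw [Matrix.mul_assoc, Matrix.mul_assoc, Matrix.trace_mul_comm, Matrix.mul_assoc,
      trace_kronecker_mul, hL]
    simp [mul_comm]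
  have hle : ∑ l, Complex.normSq (K l * σA).trace ≤ 1 := by
    have h := Finset.sum_le_sum fun l (_ : l ∈ Finset.univ) => normSq_trace_mul_le hσA (K l)
    rw [← Matrix.trace_sum, ← Finset.sum_mul, hKK, Matrix.one_mul, hσA.2] at h
    exact_mod_cast h
  refine ⟨∑ l, Complex.normSq (K l * σA).trace,
    Finset.sum_nonneg fun _ _ => Complex.normSq_nonneg _, hle, fun ρ _ => ?_⟩
  rw [sandwichΩ_eq, extFirst_eq_sum_kraus Ξ K hK, hΨ]
  have hregroup (T : Matrix ((Fin dA × Fin dB) × Fin k) ((Fin dA × Fin dB) × Fin k) ℂ) :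
      (tensorVec (Fin d) Ω)ᴴ * ((M ⊗ₖ (1 : Matrix (Fin k) (Fin k) ℂ))ᴴ * T *
        (M ⊗ₖ (1 : Matrix (Fin k) (Fin k) ℂ))) * tensorVec (Fin d) Ω = Vᴴ * T * V := by
    simp only [hV, Matrix.conjTranspose_mul, Matrix.mul_assoc]
  rw [hregroup, Matrix.mul_sum, Matrix.sum_mul, Complex.ofReal_sum, Finset.sum_smul]
  refine Finset.sum_congr rfl fun l _ => ?_
  set N := (K l ⊗ₖ (1 : Matrix (Fin dB) (Fin dB) ℂ)) ⊗ₖ (1 : Matrix (Fin k) (Fin k) ℂ)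
  calc Vᴴ * (N * (V * ρ * Vᴴ) * Nᴴ) * V = (Vᴴ * N * V) * ρ * (Vᴴ * N * V)ᴴ := by
        simp only [Matrix.conjTranspose_mul, Matrix.conjTranspose_conjTranspose, Matrix.mul_assoc]
    _ = _ := by
        rw [hW, ← Complex.mul_conj]
        simp [smul_smul, mul_comm]

end
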